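/- In a finite episodic MDP, for any two stagewise policies π and π' and every stage h ∈ {1,…,H}, the stage-h state occupancy measures satisfy ‖d_h^π − d_h^{π'}‖₁ ≤ 2·Σ_{j=1}^{h−1} E_{s∼d_j^π}[TV(π(·|s,j), π'(·|s,j))]. -/

import Mathlib

open Finset

namespace RCSL

noncomputable section

/-- Real-valued indicator of a proposition. -/
def ind (P : Prop) : ℝ :=
  haveI := Classical.propDecidable P
  if P then 1 else 0

/-- A finite (possibly stochastic) episodic MDP with horizon `H`.  Stages are 0-indexed
(`0, …, H-1` here corresponds to the paper's stages `1, …, H`). -/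
structure FinMDP (S A : Type) [Fintype S] [Fintype A] (H : ℕ) where
  /-- stochastic transition kernel: `P h s a s'` is the probability of moving to `s'` -/
  P : ℕ → S → A → S → ℝ
  P_nonneg : ∀ h s a s', 0 ≤ P h s a s'
  P_sum_one : ∀ h s a, ∑ s', P h s a s' = 1
  /-- deterministic reward function -/
  r : ℕ → S → A → ℝ
  r_nonneg : ∀ h s a, 0 ≤ r h s a
  r_le_one : ∀ h s a, r h s a ≤ 1
  /-- initial state distribution -/
  ρ : S → ℝ
  ρ_nonneg : ∀ s, 0 ≤ ρ s
  ρ_sum_one : ∑ s, ρ s = 1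

/-- Stagewise weight functions on actions; genuine policies are those satisfying `IsPolicy`. -/
abbrev Pol (S A : Type) := ℕ → S → A → ℝ

variable {S A : Type} [Fintype S] [Fintype A] [Nonempty S] [Nonempty A] {H : ℕ}

/-- `π` is a genuine stagewise policy: at every stage and state it is a probability
distribution on actions. -/
def IsPolicy (π : Pol S A) : Prop :=
  (∀ h s a, 0 ≤ π h s a) ∧ ∀ h s, ∑ a, π h s a = 1

/-- The total variation distance between two (finitely supported) distributions on `A`. -/
def tv (p q : A → ℝ) : ℝ :=
  (∑ a, |p a - q a|) / 2

/-- Length-`H` trajectories: a state–action pair at every stage. -/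
abbrev Traj (S A : Type) (H : ℕ) := Fin H → S × A

/-- The state of trajectory `τ` at (0-indexed) stage `h`. -/
def stAt (τ : Traj S A H) (h : ℕ) : S :=
  if hh : h < H then (τ ⟨h, hh⟩).1 else Classical.arbitrary S

/-- The action of trajectory `τ` at (0-indexed) stage `h`. -/
def actAt (τ : Traj S A H) (h : ℕ) : A :=
  if hh : h < H then (τ ⟨h, hh⟩).2 else Classical.arbitrary A

/-- The probability `P_β(τ)` of trajectory `τ` when the initial state is drawn from `ρ`,
actions are drawn from the policy `β`, and states follow the transition kernels. -/
def trajProb (M : FinMDP S A H) (β : Pol S A) (τ : Traj S A H) : ℝ :=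
  (if 0 < H then M.ρ (stAt τ 0) else 1) *
    (∏ h : Fin H, β h (stAt τ h) (actAt τ h)) *
    ∏ h : Fin H, (if (h : ℕ) + 1 < H then
      M.P h (stAt τ h) (actAt τ h) (stAt τ ((h : ℕ) + 1)) else 1)

/-- The return-to-go `g_h(τ) = Σ_{t ≥ h} r_t(s_t, a_t)` of trajectory `τ` from stage `h`. -/
def rtg (M : FinMDP S A H) (h : ℕ) (τ : Traj S A H) : ℝ :=
  ∑ t : Fin H, if h ≤ (t : ℕ) then M.r t (stAt τ t) (actAt τ t) else 0

/-- The stage-`h` state occupancy measure `d_h^π` of policy `π`. -/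
def occ (M : FinMDP S A H) (π : Pol S A) : ℕ → S → ℝ
  | 0 => M.ρ
  | n + 1 => fun s' => ∑ s, ∑ a, occ M π n s * π n s a * M.P n s a s'

/-- The expected total reward `J(π)` of policy `π`. -/
def J (M : FinMDP S A H) (π : Pol S A) : ℝ :=
  ∑ h ∈ Finset.range H, ∑ s, ∑ a, occ M π h s * π h s a * M.r h s a

/-- The conditional action probability `P_β(a_h = a ∣ s_h = s, g_h = g)`. -/
def condA (M : FinMDP S A H) (β : Pol S A) (h : ℕ) (s : S) (g : ℝ) (a : A) : ℝ :=
  (∑ τ : Traj S A H, trajProb M β τ * ind (stAt τ h = s ∧ actAt τ h = a ∧ rtg M h τ = g)) /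
    ∑ τ : Traj S A H, trajProb M β τ * ind (stAt τ h = s ∧ rtg M h τ = g)

/-- The in-distribution optimal return-to-go `f⋆(s, h)`. -/
def fstar (M : FinMDP S A H) (β : Pol S A) (s : S) (h : ℕ) : ℝ :=
  sSup {g : ℝ | ∃ τ : Traj S A H, 0 < trajProb M β τ ∧ stAt τ h = s ∧ rtg M h τ = g}

/-- The in-distribution optimal stitched policy `π⋆_β`. -/
def piStar (M : FinMDP S A H) (β : Pol S A) : Pol S A :=
  fun h s a => condA M β h s (fstar M β s h) a

/-- Probability that an i.i.d. dataset of `N` trajectories drawn from `P_β` satisfies `E`. -/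
def datasetProb (M : FinMDP S A H) (β : Pol S A) (N : ℕ)
    (E : (Fin N → Traj S A H) → Prop) : ℝ :=
  ∑ D : Fin N → Traj S A H, (∏ k, trajProb M β (D k)) * ind (E D)

/-- The population loss
`L(π) = Σ_h E_{τ∼P_β}[log (P_β(a_h ∣ s_h, h, g_h) / π(a_h ∣ s_h, h, g_h))]`, i.e. the
expected Kullback–Leibler divergence `E_{(s,g)∼P_β}[KL(P_β(·∣s,g) ‖ π(·∣s,g))]` summed over
stages. -/
def popLoss (M : FinMDP S A H) (β : Pol S A) (π : ℕ → S → ℝ → A → ℝ) : ℝ :=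
  ∑ h ∈ Finset.range H, ∑ τ : Traj S A H, trajProb M β τ *
    Real.log (condA M β h (stAt τ h) (rtg M h τ) (actAt τ h) /
      π h (stAt τ h) (rtg M h τ) (actAt τ h))

/-- The empirical negative log-likelihood
`Σ_{τ ∈ D} Σ_h −log π(a_h ∣ s_h, h, g_h(τ))`. -/
def empNLL (M : FinMDP S A H) {N : ℕ} (D : Fin N → Traj S A H)
    (π : ℕ → S → ℝ → A → ℝ) : ℝ :=
  ∑ k, ∑ h ∈ Finset.range H, -Real.log (π h (stAt (D k) h) (rtg M h (D k)) (actAt (D k) h))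

end

end RCSL

namespace RCSL

section

variable {S A : Type} [Fintype S] [Fintype A] {H : ℕ}

theorem occ_nonneg (M : FinMDP S A H) {π : Pol S A} (hπ : IsPolicy π) (n : ℕ) (s : S) :
    0 ≤ occ M π n s := by
  induction n generalizing s with
  | zero => exact M.ρ_nonneg s
  | succ n ih =>
    exact Finset.sum_nonneg fun t _ => Finset.sum_nonneg fun a _ =>
      mul_nonneg (mul_nonneg (ih t) (hπ.1 n t a)) (M.P_nonneg n t a s)

/-- Pushing a signed state-action weight through a transition kernel does not increase its
`ℓ¹` norm. -/
theorem sum_abs_transition_le (M : FinMDP S A H) (n : ℕ) (w : S → A → ℝ) :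
    ∑ s', |∑ s, ∑ a, w s a * M.P n s a s'| ≤ ∑ s, ∑ a, |w s a| :=
  calc ∑ s', |∑ s, ∑ a, w s a * M.P n s a s'|
      ≤ ∑ s', ∑ s, ∑ a, |w s a| * M.P n s a s' := by
        refine Finset.sum_le_sum fun s' _ => (Finset.abs_sum_le_sum_abs _ _).trans ?_
        refine Finset.sum_le_sum fun s _ => (Finset.abs_sum_le_sum_abs _ _).trans_eq ?_
        exact Finset.sum_congr rfl fun a _ => by
          rw [abs_mul, abs_of_nonneg (M.P_nonneg n s a s')]
    _ = ∑ s, ∑ a, |w s a| := by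
        rw [Finset.sum_comm]
        refine Finset.sum_congr rfl fun s _ => ?_
        rw [Finset.sum_comm]
        exact Finset.sum_congr rfl fun a _ => by rw [← Finset.mul_sum, M.P_sum_one, mul_one]

theorem sum_abs_occ_succ_sub_le (M : FinMDP S A H) {π π' : Pol S A} (hπ : IsPolicy π)
    (hπ' : IsPolicy π') (n : ℕ) :
    ∑ s, |occ M π (n + 1) s - occ M π' (n + 1) s| ≤
      ∑ s, |occ M π n s - occ M π' n s| + 2 * ∑ s, occ M π n s * tv (π n s) (π' n s) :=
  calc ∑ s, |occ M π (n + 1) s - occ M π' (n + 1) s|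
      = ∑ s', |∑ s, ∑ a, (occ M π n s * π n s a - occ M π' n s * π' n s a) * M.P n s a s'| := by
        simp only [occ, sub_mul, Finset.sum_sub_distrib]
    _ ≤ ∑ s, ∑ a, |occ M π n s * π n s a - occ M π' n s * π' n s a| :=
        sum_abs_transition_le M n _
    _ ≤ ∑ s, (|occ M π n s - occ M π' n s| + 2 * (occ M π n s * tv (π n s) (π' n s))) := by
        refine Finset.sum_le_sum fun s _ => ?_
        calc ∑ a, |occ M π n s * π n s a - occ M π' n s * π' n s a|
            ≤ ∑ a, (|occ M π n s - occ M π' n s| * π' n s a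
                + occ M π n s * |π n s a - π' n s a|) := by
              refine Finset.sum_le_sum fun a _ => ?_
              calc |occ M π n s * π n s a - occ M π' n s * π' n s a|
                  = |(occ M π n s - occ M π' n s) * π' n s a
                      + occ M π n s * (π n s a - π' n s a)| := by ring_nf
                _ ≤ _ := by
                  refine (abs_add_le _ _).trans_eq ?_
                  rw [abs_mul, abs_mul, abs_of_nonneg (hπ'.1 n s a),
                    abs_of_nonneg (occ_nonneg M hπ n s)]
          _ = |occ M π n s - occ M π' n s| + 2 * (occ M π n s * tv (π n s) (π' n s)) := by
              rw [Finset.sum_add_distrib, ← Finset.mul_sum, ← Finset.mul_sum, hπ'.2, tv]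
              ring
    _ = _ := by rw [Finset.sum_add_distrib, ← Finset.mul_sum]

end

/-- In a finite episodic MDP, for any two stagewise policies `π` and `π'`
and every stage `h`, the stage-`h` state occupancy measures satisfy
`‖d_h^π − d_h^{π'}‖₁ ≤ 2·Σ_{j<h} E_{s∼d_j^π}[TV(π(·∣s,j), π'(·∣s,j))]`
(with 0-indexed stages; the paper's stage `h ∈ {1,…,H}` is `h − 1` here). -/
theorem stmt8 {S A : Type} [Fintype S] [Fintype A] [Nonempty S] [Nonempty A] {H : ℕ}
    (M : FinMDP S A H) (π π' : Pol S A) (hπ : IsPolicy π) (hπ' : IsPolicy π')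
    (h : ℕ) (hh : h < H) :
    ∑ s, |occ M π h s - occ M π' h s| ≤
      2 * ∑ j ∈ Finset.range h, ∑ s, occ M π j s * tv (π j s) (π' j s) := by
  clear hh
  induction h with
  | zero => simp [occ]
  | succ n ih =>
    rw [Finset.sum_range_succ, mul_add]
    exact (sum_abs_occ_succ_sub_le M hπ hπ' n).trans (by gcongr)

end RCSL
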